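/- For 0 < q < 1 and nonzero complex α, β, γ, w with αβ² = −1 and βγ = q, the identity αβ = (1/2) · (q,q; q²)_∞ / [ ((αq^{1/2}/(γw))q², (αβw/q^{1/2})q²; q²)_∞ · (γw/(αq^{1/2}), q^{1/2}/(αβw); q²)_∞ ] · [ (βγw/q^{1/2}, q^{3/2}/(βγw), 1/β, βq; q)_∞ − (γw/(αβq^{1/2}), αβq^{3/2}/(γw), αβ, q/(αβ); q)_∞ ] holds, provided all denominators are nonzero. -/

import Mathlib

open Complex

/-- Infinite q-Pochhammer symbol `(a; q)_∞ = ∏_{k ≥ 0} (1 − a q^k)`. -/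
noncomputable def qPochInf (a q : ℂ) : ℂ := ∏' k : ℕ, (1 - a * q ^ k)

namespace JTP

theorem multipliable_aux (a Q : ℂ) (hQ : ‖Q‖ < 1) :
    Multipliable (fun k : ℕ => 1 - a * Q ^ k) := by
  have : Summable (fun k : ℕ => ‖-(a * Q ^ k)‖) := by
    simp only [norm_neg, norm_mul, norm_pow]
    exact (summable_geometric_of_lt_one (norm_nonneg _) hQ).mul_left _
  simpa [sub_eq_add_neg] using multipliable_one_add_of_summable this

noncomputable def P (Q : ℂ) (n : ℕ) : ℂ := ∏ k ∈ Finset.range n, (1 - Q * Q ^ k)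

noncomputable def R (Q : ℂ) (m : ℤ) : ℂ := if m < 0 then 0 else (P Q m.toNat)⁻¹

noncomputable def t (Q x : ℂ) (j : ℤ) : ℂ := (-x) ^ j * Q ^ (j * (j - 1) / 2)

noncomputable def c (Q : ℂ) (n : ℕ) (j : ℤ) : ℂ := P Q (2 * n) * (R Q (n - j) * R Q (n + j))

theorem one_sub_ne {Q : ℂ} (hQ : ‖Q‖ < 1) (k : ℕ) : 1 - Q * Q ^ k ≠ 0 := by
  intro h
  have h1 : Q ^ (k + 1) = 1 := by rw [pow_succ']; linear_combination -h
  have h2 : ‖Q‖ ^ (k + 1) = 1 := by rw [← norm_pow, h1, norm_one]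
  have h3 : ‖Q‖ ^ (k + 1) < 1 := pow_lt_one₀ (norm_nonneg _) hQ (by omega)
  linarith

theorem P_ne {Q : ℂ} (hQ : ‖Q‖ < 1) (n : ℕ) : P Q n ≠ 0 :=
  Finset.prod_ne_zero_iff.2 fun k _ => one_sub_ne hQ k

theorem R_step {Q : ℂ} (hQ : ‖Q‖ < 1) (m : ℤ) :
    R Q (m - 1) = (1 - Q ^ m) * R Q m := by
  rcases lt_trichotomy m 0 with h | h | h
  · simp [R, h, show m - 1 < 0 by omega]
  · simp [R, h]
  · obtain ⟨n, rfl⟩ : ∃ n : ℕ, m = n + 1 := ⟨(m - 1).toNat, by omega⟩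
    have h1 : ¬ ((n : ℤ) + 1 < 0) := by omega
    have h2 : ((n : ℤ) + 1).toNat = n + 1 := by omega
    have h3 : Q ^ ((n : ℤ) + 1) = Q * Q ^ n := by
      rw [show (n : ℤ) + 1 = ((n + 1 : ℕ) : ℤ) by push_cast; rfl, zpow_natCast, pow_succ']
    have h4 : P Q (n + 1) = P Q n * (1 - Q * Q ^ n) := by simp [P, Finset.prod_range_succ]
    have := P_ne hQ n
    have := one_sub_ne hQ n
    simp only [R, h1, h2, h3, h4, add_sub_cancel_right, if_false, Int.toNat_natCast]
    rw [if_neg (by omega)]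
    field_simp

theorem t_succ {Q x : ℂ} (hQ : Q ≠ 0) (hx : x ≠ 0) (j : ℤ) :
    t Q x (j + 1) = -x * Q ^ j * t Q x j := by
  have : (j + 1) * (j + 1 - 1) / 2 = j + j * (j - 1) / 2 := by
    rw [show (j + 1) * (j + 1 - 1) = j * (j - 1) + j * 2 by ring,
      Int.add_mul_ediv_right _ _ (by norm_num)]
    ring
  rw [t, t, this, zpow_add₀ hQ, zpow_add_one₀ (neg_ne_zero.2 hx)]
  ring

theorem c_step {Q : ℂ} (hQ0 : Q ≠ 0) (hQ : ‖Q‖ < 1) (n : ℕ) (j : ℤ) :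
    c Q (n + 1) j = (1 + Q ^ (2 * n + 1)) * c Q n j + Q ^ ((n : ℤ) + 1 - j) * c Q n (j - 1)
      + Q ^ ((n : ℤ) + 1 + j) * c Q n (j + 1) := by
  have e1 : R Q (n - j) = (1 - Q ^ ((n : ℤ) + 1 - j)) * R Q (n + 1 - j) := by
    rw [← R_step hQ]; congr 1; ring
  have e2 : R Q (n + j) = (1 - Q ^ ((n : ℤ) + 1 + j)) * R Q (n + 1 + j) := by
    rw [← R_step hQ]; congr 1; ring
  have e3 : R Q (n + (j - 1)) = (1 - Q ^ ((n : ℤ) + j)) * R Q (n + j) := by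
    rw [← R_step hQ]; congr 1; ring
  have e4 : R Q (n - (j + 1)) = (1 - Q ^ ((n : ℤ) - j)) * R Q (n - j) := by
    rw [← R_step hQ]; congr 1; ring
  have e5 : P Q (2 * (n + 1)) = P Q (2 * n) * (1 - Q ^ (2 * n + 1)) * (1 - Q ^ (2 * n + 2)) := by
    rw [show 2 * (n + 1) = 2 * n + 1 + 1 by ring]
    simp only [P, Finset.prod_range_succ]
    ring
  have u : Q ^ ((n : ℤ) + 1 - j) = Q * Q ^ ((n : ℤ) - j) := by
    rw [show (n : ℤ) + 1 - j = (n - j) + 1 by ring, zpow_add_one₀ hQ0]; ring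
  have v : Q ^ ((n : ℤ) + 1 + j) = Q * Q ^ ((n : ℤ) + j) := by
    rw [show (n : ℤ) + 1 + j = (n + j) + 1 by ring, zpow_add_one₀ hQ0]; ring
  have uv : Q ^ (2 * n) = Q ^ ((n : ℤ) - j) * Q ^ ((n : ℤ) + j) := by
    rw [← zpow_add₀ hQ0, ← zpow_natCast]; congr 1; push_cast; ring
  unfold c
  rw [e3, e4, show ((n : ℤ) - (j - 1)) = n + 1 - j by ring,
    show ((n : ℤ) + (j + 1)) = n + 1 + j by ring, e1, e2, e5, u, v, pow_add, pow_add, uv]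
  push_cast
  ring

theorem finite_jtp {Q x : ℂ} (hQ0 : Q ≠ 0) (hQ : ‖Q‖ < 1) (hx : x ≠ 0) (n : ℕ) :
    HasSum (fun j : ℤ => c Q n j * t Q x j)
      ((∏ k ∈ Finset.range n, (1 - x * Q ^ k)) * ∏ k ∈ Finset.range n, (1 - Q / x * Q ^ k)) := by
  induction n with
  | zero =>
    have := hasSum_single (f := fun j : ℤ => c Q 0 j * t Q x j) 0 (by
      intro j hj
      rcases lt_or_gt_of_ne hj with h | h
      · simp [c, R, h]
      · simp [c, R, h])
    simpa [c, R, P, t] using this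
  | succ n ih =>
    have h1 := ih.mul_left (1 + Q ^ (2 * n + 1))
    have h2 := ((Equiv.subRight (1 : ℤ)).hasSum_iff.2 ih).mul_left (-x * Q ^ n)
    have h3 := ((Equiv.addRight (1 : ℤ)).hasSum_iff.2 ih).mul_left (-(Q * Q ^ n / x))
    have h := (h1.add h2).add h3
    convert h using 1
    · rfl
    · funext j
      simp only [Function.comp, Equiv.subRight_apply, Equiv.coe_addRight]
      have hj : t Q x j = -x * Q ^ (j - 1) * t Q x (j - 1) := by
        rw [← t_succ hQ0 hx]; congr 1; ring
      have hz : Q ^ ((n : ℤ) + 1 - j) * Q ^ (j - 1) = Q ^ n := by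
        rw [← zpow_add₀ hQ0, ← zpow_natCast]; congr 1; ring
      have hz2 : Q ^ ((n : ℤ) + 1 + j) = Q * Q ^ n * Q ^ j := by
        rw [zpow_add₀ hQ0, zpow_add_one₀ hQ0, zpow_natCast]; ring
      rw [c_step hQ0 hQ, t_succ hQ0 hx j, hz2]
      have hA : Q ^ ((n : ℤ) + 1 - j) * t Q x j = -x * Q ^ n * t Q x (j - 1) := by
        rw [hj, ← hz]; ring
      have hB : Q * Q ^ n / x * x = Q * Q ^ n := by field_simp
      linear_combination (c Q n (j - 1)) * hA - c Q n (j+1) * Q ^ j * t Q x j * hB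
    · rw [Finset.prod_range_succ, Finset.prod_range_succ]
      field_simp
      ring

theorem summable_nat {Q x : ℂ} (hQ0 : Q ≠ 0) (hQ : ‖Q‖ < 1) (hx : x ≠ 0) :
    Summable (fun n : ℕ => ‖t Q x n‖) := by
  have hne : ∀ j, t Q x j ≠ 0 := fun j =>
    mul_ne_zero (zpow_ne_zero _ (neg_ne_zero.2 hx)) (zpow_ne_zero _ hQ0)
  refine summable_of_ratio_test_tendsto_lt_one (l := 0) (by norm_num)
    (Filter.Eventually.of_forall fun n => by simpa using hne n) ?_
  have : ∀ n : ℕ, ‖‖t Q x ((n + 1 : ℕ) : ℤ)‖‖ / ‖‖t Q x n‖‖ = ‖x‖ * ‖Q‖ ^ n := by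
    intro n
    have h0 := norm_ne_zero_iff.2 (hne n)
    push_cast
    rw [t_succ hQ0 hx]
    simp only [norm_norm, norm_mul, norm_neg, zpow_natCast, norm_pow]
    field_simp
  simp only [this]
  simpa using (tendsto_pow_atTop_nhds_zero_of_lt_one (norm_nonneg _) hQ).const_mul ‖x‖

theorem summable_t {Q x : ℂ} (hQ0 : Q ≠ 0) (hQ : ‖Q‖ < 1) (hx : x ≠ 0) :
    Summable (fun j : ℤ => ‖t Q x j‖) := by
  refine Summable.of_nat_of_neg (summable_nat hQ0 hQ hx) ?_
  have := summable_nat hQ0 hQ (div_ne_zero hQ0 hx)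
  refine this.congr fun n => ?_
  have e : (-(n : ℤ)) * (-(n : ℤ) - 1) / 2 = n + (n : ℤ) * (n - 1) / 2 := by
    rw [show (-(n : ℤ)) * (-(n : ℤ) - 1) = (n : ℤ) * (n - 1) + n * 2 by ring,
      Int.add_mul_ediv_right _ _ (by norm_num)]
    ring
  rw [t, t, e, zpow_add₀ hQ0, zpow_neg, ← inv_zpow, ← mul_assoc, ← mul_zpow]
  congr 2
  field_simp

theorem tendsto_P {Q : ℂ} (hQ : ‖Q‖ < 1) :
    Filter.Tendsto (P Q) Filter.atTop (nhds (qPochInf Q Q)) :=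
  (multipliable_aux Q Q hQ).hasProd.tendsto_prod_nat

theorem qP_ne {Q : ℂ} (hQ : ‖Q‖ < 1) : qPochInf Q Q ≠ 0 := by
  have : Summable (fun k : ℕ => ‖-(Q * Q ^ k)‖) := by
    simp only [norm_neg, norm_mul, norm_pow]
    exact (summable_geometric_of_lt_one (norm_nonneg _) hQ).mul_left _
  have h := tprod_one_add_ne_zero_of_summable (f := fun k : ℕ => -(Q * Q ^ k))
    (fun k => by simpa [sub_eq_add_neg] using one_sub_ne hQ k) this
  simpa [qPochInf, sub_eq_add_neg] using h

theorem jtp {Q x : ℂ} (hQ0 : Q ≠ 0) (hQ : ‖Q‖ < 1) (hx : x ≠ 0) :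
    ∑' j : ℤ, t Q x j = qPochInf Q Q * (qPochInf x Q * qPochInf (Q / x) Q) := by
  have hP := tendsto_P hQ
  have hP0 := qP_ne hQ
  have hR : Filter.Tendsto (fun n : ℕ => (P Q n)⁻¹) Filter.atTop (nhds (qPochInf Q Q)⁻¹) :=
    hP.inv₀ hP0
  obtain ⟨A, hA⟩ := hP.norm.bddAbove_range
  obtain ⟨B, hB⟩ := hR.norm.bddAbove_range
  have hA' : ∀ n, ‖P Q n‖ ≤ A := fun n => hA ⟨n, rfl⟩
  have hB' : ∀ n, ‖(P Q n)⁻¹‖ ≤ B := fun n => hB ⟨n, rfl⟩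
  have hA0 : 0 ≤ A := (norm_nonneg _).trans (hA' 0)
  have hB0 : 0 ≤ B := (norm_nonneg _).trans (hB' 0)
  have hRb : ∀ m, ‖R Q m‖ ≤ B := by
    intro m
    unfold R
    split_ifs
    · simpa using hB0
    · exact hB' _
  have hRt : Filter.Tendsto (R Q) Filter.atTop (nhds (qPochInf Q Q)⁻¹) := by
    have : Filter.Tendsto (fun m : ℤ => (P Q m.toNat)⁻¹) Filter.atTop (nhds (qPochInf Q Q)⁻¹) :=
      hR.comp (Filter.tendsto_atTop.2 fun b => by
        filter_upwards [Filter.eventually_ge_atTop (b : ℤ)] with m hm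
        omega)
    refine this.congr' ?_
    filter_upwards [Filter.eventually_ge_atTop (0 : ℤ)] with m hm
    simp [R, not_lt.2 hm]
  have key := tendsto_tsum_of_dominated_convergence (𝓕 := Filter.atTop)
    (f := fun (n : ℕ) (j : ℤ) => c Q n j * t Q x j)
    (g := fun j => (qPochInf Q Q)⁻¹ * t Q x j)
    (bound := fun j => A * (B * B) * ‖t Q x j‖)
    ((summable_t hQ0 hQ hx).mul_left _)
    (by
      intro j
      refine Filter.Tendsto.mul_const _ ?_
      have h1 : Filter.Tendsto (fun n : ℕ => P Q (2 * n)) Filter.atTop (nhds (qPochInf Q Q)) :=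
        hP.comp (Filter.tendsto_atTop_mono (fun n => by simp only [id]; omega) Filter.tendsto_id)
      have h2 : Filter.Tendsto (fun n : ℕ => R Q ((n : ℤ) - j)) Filter.atTop
          (nhds (qPochInf Q Q)⁻¹) :=
        hRt.comp (Filter.tendsto_atTop_add_const_right _ (-j) tendsto_natCast_atTop_atTop)
      have h3 : Filter.Tendsto (fun n : ℕ => R Q ((n : ℤ) + j)) Filter.atTop
          (nhds (qPochInf Q Q)⁻¹) :=
        hRt.comp (Filter.tendsto_atTop_add_const_right _ j tendsto_natCast_atTop_atTop)
      have h4 := h1.mul (h2.mul h3)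
      rw [mul_inv_cancel_left₀ hP0] at h4
      exact h4)
    (Filter.Eventually.of_forall fun n j => by
      rw [norm_mul, c, norm_mul, norm_mul]
      have := hA' (2 * n)
      have := hRb (n - j)
      have := hRb (n + j)
      gcongr)
  have lim2 : Filter.Tendsto (fun n : ℕ => ∑' j : ℤ, c Q n j * t Q x j) Filter.atTop
      (nhds (qPochInf x Q * qPochInf (Q / x) Q)) := by
    simp only [fun n => (finite_jtp hQ0 hQ hx n).tsum_eq]
    exact (multipliable_aux x Q hQ).hasProd.tendsto_prod_nat.mul
      (multipliable_aux (Q / x) Q hQ).hasProd.tendsto_prod_nat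
  have := tendsto_nhds_unique key lim2
  rw [tsum_mul_left] at this
  rw [← this, mul_inv_cancel_left₀ hP0]

theorem split {Q : ℂ} (hQ : ‖Q‖ < 1) :
    qPochInf Q Q = qPochInf Q (Q ^ 2) * qPochInf (Q ^ 2) (Q ^ 2) := by
  have hQ2 : ‖Q ^ 2‖ < 1 := by rw [norm_pow]; exact pow_lt_one₀ (norm_nonneg _) hQ (by norm_num)
  have e1 : ∀ k : ℕ, 1 - Q * (Q ^ 2) ^ k = 1 - Q * Q ^ (2 * k) := fun k => by rw [pow_mul]
  have e2 : ∀ k : ℕ, 1 - Q ^ 2 * (Q ^ 2) ^ k = 1 - Q * Q ^ (2 * k + 1) := fun k => by ring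
  have m1 := multipliable_aux Q (Q ^ 2) hQ2
  have m2 := multipliable_aux (Q ^ 2) (Q ^ 2) hQ2
  unfold qPochInf
  simp only [e1, e2] at m1 m2 ⊢
  exact (tprod_even_mul_odd (f := fun k => 1 - Q * Q ^ k) m1 m2).symm

theorem sum_identity {q x b : ℂ} (hq0 : q ≠ 0) (hq : ‖q‖ < 1) (hx : x ≠ 0) (hb : b ≠ 0) :
    (∑' j, t q x j) * (∑' j, t q b j) - (∑' j, t q (-x) j) * (∑' j, t q (-b) j) =
      -2 * b * ((∑' j, t (q ^ 2) (-(x / b)) j) * (∑' j, t (q ^ 2) (-(q / (b * x))) j)) := by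
  have hq2 : ‖q ^ 2‖ < 1 := by rw [norm_pow]; exact pow_lt_one₀ (norm_nonneg _) hq (by norm_num)
  have hq20 : q ^ 2 ≠ 0 := pow_ne_zero _ hq0
  have S1 := summable_t hq0 hq hx
  have S2 := summable_t hq0 hq hb
  have S3 := summable_t hq0 hq (neg_ne_zero.2 hx)
  have S4 := summable_t hq0 hq (neg_ne_zero.2 hb)
  have S5 := summable_t hq20 hq2 (neg_ne_zero.2 (div_ne_zero hx hb))
  have S6 := summable_t hq20 hq2 (neg_ne_zero.2 (div_ne_zero hq0 (mul_ne_zero hb hx)))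
  rw [tsum_mul_tsum_of_summable_norm S1 S2, tsum_mul_tsum_of_summable_norm S3 S4,
    tsum_mul_tsum_of_summable_norm S5 S6,
    ← (summable_mul_of_summable_norm S1 S2).tsum_sub (summable_mul_of_summable_norm S3 S4),
    ← tsum_mul_left]
  let φ : ℤ × ℤ → ℤ × ℤ := fun p => (p.1 - p.2, 1 - p.1 - p.2)
  have hφ : Function.Injective φ := by
    rintro ⟨a, b⟩ ⟨c, d⟩ h
    simp only [φ, Prod.mk.injEq] at h ⊢
    omega
  have hneg : ∀ (y : ℂ) (j : ℤ), t q (-y) j = (-1) ^ j * t q y j := by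
    intro y j
    rw [t, t, ← mul_assoc, ← mul_zpow]; congr 2; ring
  rw [← hφ.tsum_eq]
  · refine tsum_congr ?_
    rintro ⟨k, l⟩
    simp only [φ, hneg]
    have s : ((-1 : ℂ)) ^ (k - l) * (-1) ^ (1 - k - l) = -1 := by
      rw [← zpow_add₀ (by norm_num), show k - l + (1 - k - l) = 2 * (-l) + 1 by ring,
        zpow_add_one₀ (by norm_num), zpow_mul]
      norm_num
    have eq1 : t q x (k - l) * t q b (1 - k - l) =
        - (b * (t (q ^ 2) (-(x / b)) k * t (q ^ 2) (-(q / (b * x))) l)) := by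
      obtain ⟨a1, h1⟩ := Int.even_mul_pred_self (k - l)
      obtain ⟨a2, h2⟩ := Int.even_mul_pred_self (1 - k - l)
      obtain ⟨a3, h3⟩ := Int.even_mul_pred_self k
      obtain ⟨a4, h4⟩ := Int.even_mul_pred_self l
      have d1 : (k - l) * (k - l - 1) / 2 = a1 := by omega
      have d2 : (1 - k - l) * (1 - k - l - 1) / 2 = a2 := by omega
      have d3 : k * (k - 1) / 2 = a3 := by omega
      have d4 : l * (l - 1) / 2 = a4 := by omega
      have e : a1 + a2 = 2 * a3 + 2 * a4 + l := by linarith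
      have hqq : q ^ a1 * q ^ a2 = (q ^ 2) ^ a3 * (q ^ 2) ^ a4 * q ^ l := by
        rw [← zpow_add₀ hq0, e, zpow_add₀ hq0, zpow_add₀ hq0, zpow_mul, zpow_mul]
        norm_cast
      have hx1 : (-x) ^ (k - l) * (-b) ^ (1 - k - l) = -b * ((x / b) ^ k * (1 / (b * x)) ^ l) := by
        rw [← neg_one_mul x, ← neg_one_mul b, mul_zpow, mul_zpow,
          show (-1 : ℂ) ^ (k - l) * x ^ (k - l) * ((-1) ^ (1 - k - l) * b ^ (1 - k - l)) =
            ((-1 : ℂ) ^ (k - l) * (-1) ^ (1 - k - l)) * (x ^ (k - l) * b ^ (1 - k - l)) by ring, s,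
          zpow_sub₀ hx, zpow_sub₀ hb, zpow_sub₀ hb, div_zpow, div_zpow, mul_zpow]
        simp
        field_simp
      have hl : (q / (b * x)) ^ l = (1 / (b * x)) ^ l * q ^ l := by
        rw [← mul_zpow]; congr 1; ring
      simp only [t, d1, d2, d3, d4, neg_neg, hl]
      linear_combination (q ^ a1 * q ^ a2) * hx1 -
        b * ((x / b) ^ k * (1 / (b * x)) ^ l) * hqq
    linear_combination (-(t q x (k - l) * t q b (1 - k - l))) * s + 2 * eq1
  · rintro ⟨m, n⟩ hmn
    rw [Function.mem_support] at hmn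
    simp only [hneg] at hmn
    rcases Int.even_or_odd (m + n) with h | h
    · exfalso
      apply hmn
      have : ((-1 : ℂ)) ^ m * (-1) ^ n = 1 := by
        rw [← zpow_add₀ (by norm_num), h.neg_one_zpow]
      linear_combination (-(t q x m * t q b n)) * this
    · obtain ⟨r, hr⟩ := h
      exact ⟨(m - r, -r), by simp only [φ, Prod.mk.injEq]; omega⟩

theorem theta_identity {q x b : ℂ} (hq0 : q ≠ 0) (hq : ‖q‖ < 1) (hx : x ≠ 0) (hb : b ≠ 0) :
    (qPochInf q (q ^ 2)) ^ 2 *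
      (qPochInf x q * qPochInf (q / x) q * (qPochInf b q * qPochInf (q / b) q) -
        qPochInf (-x) q * qPochInf (q / -x) q * (qPochInf (-b) q * qPochInf (q / -b) q)) =
      -2 * b * (qPochInf (-(x / b)) (q ^ 2) * qPochInf (q ^ 2 / -(x / b)) (q ^ 2) *
        (qPochInf (-(q / (b * x))) (q ^ 2) * qPochInf (q ^ 2 / -(q / (b * x))) (q ^ 2))) := by
  have hq2 : ‖q ^ 2‖ < 1 := by rw [norm_pow]; exact pow_lt_one₀ (norm_nonneg _) hq (by norm_num)
  have hq20 : q ^ 2 ≠ 0 := pow_ne_zero _ hq0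
  have h := sum_identity hq0 hq hx hb
  rw [jtp hq0 hq hx, jtp hq0 hq hb, jtp hq0 hq (neg_ne_zero.2 hx), jtp hq0 hq (neg_ne_zero.2 hb),
    jtp hq20 hq2 (neg_ne_zero.2 (div_ne_zero hx hb)),
    jtp hq20 hq2 (neg_ne_zero.2 (div_ne_zero hq0 (mul_ne_zero hb hx))), split hq] at h
  have h0 : (qPochInf (q ^ 2) (q ^ 2)) ^ 2 ≠ 0 := pow_ne_zero _ (qP_ne hq2)
  apply mul_left_cancel₀ h0
  linear_combination h

end JTP

theorem product_identity_two (q : ℝ) (α β γ w : ℂ)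
    (hq : 0 < q) (hq1 : q < 1)
    (hα : α ≠ 0) (hβ : β ≠ 0) (hγ : γ ≠ 0) (hw : w ≠ 0)
    (hc1 : α * β ^ 2 = -1) (hc2 : β * γ = (q : ℂ))
    (hd : qPochInf (α * (Real.sqrt q : ℂ) / (γ * w) * (q : ℂ) ^ 2) ((q : ℂ) ^ 2) *
          qPochInf (α * β * w / (Real.sqrt q : ℂ) * (q : ℂ) ^ 2) ((q : ℂ) ^ 2) *
          (qPochInf (γ * w / (α * (Real.sqrt q : ℂ))) ((q : ℂ) ^ 2) *
            qPochInf ((Real.sqrt q : ℂ) / (α * β * w)) ((q : ℂ) ^ 2)) ≠ 0) :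
    α * β =
      (1 / 2) *
        (qPochInf (q : ℂ) ((q : ℂ) ^ 2) * qPochInf (q : ℂ) ((q : ℂ) ^ 2)) /
        (qPochInf (α * (Real.sqrt q : ℂ) / (γ * w) * (q : ℂ) ^ 2) ((q : ℂ) ^ 2) *
          qPochInf (α * β * w / (Real.sqrt q : ℂ) * (q : ℂ) ^ 2) ((q : ℂ) ^ 2) *
          (qPochInf (γ * w / (α * (Real.sqrt q : ℂ))) ((q : ℂ) ^ 2) *
            qPochInf ((Real.sqrt q : ℂ) / (α * β * w)) ((q : ℂ) ^ 2))) *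
        (qPochInf (β * γ * w / (Real.sqrt q : ℂ)) (q : ℂ) *
            qPochInf ((q : ℂ) * (Real.sqrt q : ℂ) / (β * γ * w)) (q : ℂ) *
            qPochInf (1 / β) (q : ℂ) * qPochInf (β * (q : ℂ)) (q : ℂ)
          -
          qPochInf (γ * w / (α * β * (Real.sqrt q : ℂ))) (q : ℂ) *
            qPochInf (α * β * (q : ℂ) * (Real.sqrt q : ℂ) / (γ * w)) (q : ℂ) *
            qPochInf (α * β) (q : ℂ) * qPochInf ((q : ℂ) / (α * β)) (q : ℂ)) := by
  have hs0 : (Real.sqrt q : ℂ) ≠ 0 := by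
    exact_mod_cast (Real.sqrt_pos.2 hq).ne'
  have hs2 : (Real.sqrt q : ℂ) ^ 2 = (q : ℂ) := by
    exact_mod_cast Real.sq_sqrt hq.le
  have hq0 : (q : ℂ) ≠ 0 := by exact_mod_cast hq.ne'
  have hqn : ‖(q : ℂ)‖ < 1 := by
    rw [Complex.norm_real, Real.norm_of_nonneg hq.le]; exact hq1
  have ha : α = -1 / β ^ 2 := by field_simp; exact hc1
  have hg : γ = (q : ℂ) / β := by field_simp; linear_combination hc2
  have T := JTP.theta_identity (x := (Real.sqrt q : ℂ) * w) (b := 1 / β) hq0 hqn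
    (mul_ne_zero hs0 hw) (one_div_ne_zero hβ)
  generalize hD : qPochInf (α * (Real.sqrt q : ℂ) / (γ * w) * (q : ℂ) ^ 2) ((q : ℂ) ^ 2) *
          qPochInf (α * β * w / (Real.sqrt q : ℂ) * (q : ℂ) ^ 2) ((q : ℂ) ^ 2) *
          (qPochInf (γ * w / (α * (Real.sqrt q : ℂ))) ((q : ℂ) ^ 2) *
            qPochInf ((Real.sqrt q : ℂ) / (α * β * w)) ((q : ℂ) ^ 2)) = D at *
  have a1 : α * (Real.sqrt q : ℂ) / (γ * w) * (q : ℂ) ^ 2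
      = (q : ℂ) ^ 2 / -((Real.sqrt q : ℂ) * w / (1 / β)) := by
    rw [ha, hg, ← hs2]; field_simp
  have a2 : α * β * w / (Real.sqrt q : ℂ) * (q : ℂ) ^ 2
      = (q : ℂ) ^ 2 / -((q : ℂ) / (1 / β * ((Real.sqrt q : ℂ) * w))) := by
    rw [ha, ← hs2]; field_simp
  have a3 : γ * w / (α * (Real.sqrt q : ℂ)) = -((Real.sqrt q : ℂ) * w / (1 / β)) := by
    rw [ha, hg, ← hs2]; field_simp
  have a4 : (Real.sqrt q : ℂ) / (α * β * w)
      = -((q : ℂ) / (1 / β * ((Real.sqrt q : ℂ) * w))) := by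
    rw [ha, ← hs2]; field_simp
  have b1 : β * γ * w / (Real.sqrt q : ℂ) = (Real.sqrt q : ℂ) * w := by
    rw [hc2, ← hs2]; field_simp
  have b2 : (q : ℂ) * (Real.sqrt q : ℂ) / (β * γ * w) = (q : ℂ) / ((Real.sqrt q : ℂ) * w) := by
    rw [hc2, ← hs2]; field_simp
  have b3 : β * (q : ℂ) = (q : ℂ) / (1 / β) := by field_simp
  have b4 : γ * w / (α * β * (Real.sqrt q : ℂ)) = -((Real.sqrt q : ℂ) * w) := by
    rw [ha, hg, ← hs2]; field_simp
  have b5 : α * β * (q : ℂ) * (Real.sqrt q : ℂ) / (γ * w)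
      = (q : ℂ) / -((Real.sqrt q : ℂ) * w) := by
    rw [ha, hg, ← hs2]; field_simp
  have b6 : α * β = -(1 / β) := by rw [ha]; field_simp
  rw [a1, a2, a3, a4] at hD
  rw [b1, b2, b3, b4, b5, b6]
  rw [div_mul_eq_mul_div, eq_div_iff hd, ← hD]
  linear_combination (-1 / 2) * T
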